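/- For n ≥ 4, let D_n denote the graph on vertex set {1,…,n} with edges {1,3}, {2,3}, and {i, i+1} for 3 ≤ i ≤ n−1 (the simply-laced Dynkin diagram of type D_n). Then the Hilbert series of E_{D_n} satisfies Σ_{d≥0} (dim_ℚ E_{D_n}^d)·t^d = [n]·[n−1]·[4]·[6]·[8]⋯[2n−4] as polynomials with integer coefficients, where [k] := 1 + t + t² + ⋯ + t^{k−1}. In particular, E_{D_n} is finite-dimensional and dim_ℚ E_{D_n} = 2^{n−3}·n!. -/

import Mathlib

open scoped TensorProduct

namespace FK

/-- Defining relations of the Fomin–Kirillov algebra `E n`, with generators indexed by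
ordered pairs `(i, j)`; we also impose `x_{ii} = 0` and the antisymmetry `x_{ji} = -x_{ij}`,
so that the generators of the algebra are the `x_{ij}` for `i < j`. -/
inductive Rel (n : ℕ) : FreeAlgebra ℚ (Fin n × Fin n) → FreeAlgebra ℚ (Fin n × Fin n) → Prop
  | diag (i : Fin n) : Rel n (FreeAlgebra.ι ℚ (i, i)) 0
  | antisymm (i j : Fin n) (hij : i ≠ j) :
      Rel n (FreeAlgebra.ι ℚ (j, i)) (-FreeAlgebra.ι ℚ (i, j))
  | square (i j : Fin n) (hij : i ≠ j) :
      Rel n (FreeAlgebra.ι ℚ (i, j) * FreeAlgebra.ι ℚ (i, j)) 0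
  | comm (i j k l : Fin n) (h : List.Nodup [i, j, k, l]) :
      Rel n (FreeAlgebra.ι ℚ (i, j) * FreeAlgebra.ι ℚ (k, l))
        (FreeAlgebra.ι ℚ (k, l) * FreeAlgebra.ι ℚ (i, j))
  | cyclic (i j k : Fin n) (h : List.Nodup [i, j, k]) :
      Rel n (FreeAlgebra.ι ℚ (i, j) * FreeAlgebra.ι ℚ (j, k)
        + FreeAlgebra.ι ℚ (j, k) * FreeAlgebra.ι ℚ (k, i)
        + FreeAlgebra.ι ℚ (k, i) * FreeAlgebra.ι ℚ (i, j)) 0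

/-- The Fomin–Kirillov algebra `E n`. -/
abbrev E (n : ℕ) : Type := RingQuot (Rel n)

/-- The generator `x_{ij}` of `E n`. -/
noncomputable def x (n : ℕ) (i j : Fin n) : E n :=
  RingQuot.mkAlgHom ℚ (Rel n) (FreeAlgebra.ι ℚ (i, j))

/-- The product of generators `x_{i₁j₁} ⋯ x_{i_d j_d}` given by a list of pairs. -/
noncomputable def word (n : ℕ) (l : List (Fin n × Fin n)) : E n :=
  (l.map fun p => x n p.1 p.2).prod

/-- The degree-`d` component of `E n`: the span of products of `d` generators. -/
def degSpan (n : ℕ) (d : ℕ) : Submodule ℚ (E n) :=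
  Submodule.span ℚ {y | ∃ l : List (Fin n × Fin n),
    (∀ p ∈ l, p.1 ≠ p.2) ∧ l.length = d ∧ y = word n l}

/-- The Fomin–Kirillov algebra of a graph `G`: the subalgebra of `E n` generated by the
`x_{ij}` with `{i,j}` an edge of `G`. -/
def EG (n : ℕ) (G : SimpleGraph (Fin n)) : Subalgebra ℚ (E n) :=
  Algebra.adjoin ℚ {y | ∃ i j : Fin n, G.Adj i j ∧ y = x n i j}

/-- The degree-`d` component `E_G^d = E_G ∩ E_n^d`. -/
def EGdeg (n : ℕ) (G : SimpleGraph (Fin n)) (d : ℕ) : Submodule ℚ (E n) :=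
  (EG n G).toSubmodule ⊓ degSpan n d

/-- The positive-degree part `E_G⁺` of `E_G`. -/
def EGplus (n : ℕ) (G : SimpleGraph (Fin n)) : Submodule ℚ (E n) :=
  ⨆ d : ℕ, ⨆ _ : 1 ≤ d, EGdeg n G d


/-- The `q`-integer `[k] = 1 + t + ⋯ + t^{k-1}` as a polynomial with natural-number
coefficients. -/
noncomputable def qint (k : ℕ) : Polynomial ℕ :=
  ∑ i ∈ Finset.range k, Polynomial.X ^ i

/-- The simply-laced Dynkin diagram `D_n` on `{1,…,n}` (here `0`-indexed on `Fin n`):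
edges `{0,2}`, `{1,2}`, and `{i, i+1}` for `2 ≤ i ≤ n-2`. -/
def dynkinD (n : ℕ) : SimpleGraph (Fin n) :=
  SimpleGraph.fromRel fun i j =>
    ((i : ℕ) = 0 ∧ (j : ℕ) = 2) ∨ ((i : ℕ) = 1 ∧ (j : ℕ) = 2) ∨
      (2 ≤ (i : ℕ) ∧ (j : ℕ) = (i : ℕ) + 1)


section Upper
variable {R : Type*} [Ring R] [Algebra ℚ R]

/-- The relations among the generators of the subalgebra of type `D`. -/
structure Rels (g : Bool → R) (f : ℕ → R) : Prop where
  gg : ∀ t, g t * g t = 0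
  gbr : ∀ t, g t * g (!t) * g t = - (g (!t) * g t * g (!t))
  ff : ∀ i, f i * f i = 0
  fbr : ∀ i, f i * f (i+1) * f i = f (i+1) * f i * f (i+1)
  fcomm : ∀ i j, i + 2 ≤ j → f i * f j = f j * f i
  gf : ∀ t i, g t * f (i+1) = f (i+1) * g t
  gfbr : ∀ t, g t * f 0 * g t = - (f 0 * g t * f 0)
  claw : ∀ t, f 0 * g t * g (!t) * f 0 =
    - (g t * g (!t) * f 0 * g t) - g (!t) * f 0 * g t * g (!t)

def gens (g : Bool → R) (f : ℕ → R) : ℕ → Set R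
  | 0 => ∅
  | q+1 => Set.range g ∪ f '' {i | i < q}

def AA (g : Bool → R) (f : ℕ → R) (q : ℕ) : Subalgebra ℚ R := Algebra.adjoin ℚ (gens g f q)

def tt (g : Bool → R) (f : ℕ → R) : ℕ → R
  | 0 => g false * g true * g false
  | q+1 => f q * tt g f q * f q

def TT (g : Bool → R) (f : ℕ → R) (q : ℕ) : Submodule ℚ R :=
  Submodule.span ℚ {z | z ∈ AA g f (q+1) ∨
    (∃ u ∈ AA g f (q+1), ∃ v ∈ AA g f (q+1), z = u * f q * v) ∨
    (∃ u ∈ AA g f (q+1), z = u * tt g f (q+1))}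

theorem adjoin_le_of_right (S : Set R) (M : Submodule ℚ R) (h1 : (1 : R) ∈ M)
    (h : ∀ z ∈ M, ∀ s ∈ S, z * s ∈ M) : Subalgebra.toSubmodule (Algebra.adjoin ℚ S) ≤ M := by
  rw [Algebra.adjoin_eq_span, Submodule.span_le]
  intro z hz
  induction hz using Submonoid.closure_induction_right with
  | one => exact h1
  | mul_right x hx y hy ih => exact h _ ih _ hy

theorem span_mul_right {S : Set R} {M : Submodule ℚ R} {s : R} (h : ∀ z ∈ S, z * s ∈ M) :
    ∀ z ∈ Submodule.span ℚ S, z * s ∈ M := by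
  intro z hz
  have : Submodule.span ℚ S ≤ M.comap (LinearMap.mulRight ℚ s) := by
    rw [Submodule.span_le]; intro y hy; exact h y hy
  exact this hz

theorem span_mul_left {S : Set R} {M : Submodule ℚ R} {s : R} (h : ∀ z ∈ S, s * z ∈ M) :
    ∀ z ∈ Submodule.span ℚ S, s * z ∈ M := by
  intro z hz
  have : Submodule.span ℚ S ≤ M.comap (LinearMap.mulLeft ℚ s) := by
    rw [Submodule.span_le]; intro y hy; exact h y hy
  exact this hz

variable {g : Bool → R} {f : ℕ → R}

theorem g_mem (t : Bool) (q : ℕ) : g t ∈ AA g f (q+1) :=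
  Algebra.subset_adjoin (Or.inl ⟨t, rfl⟩)

theorem f_mem {i q : ℕ} (h : i < q) : f i ∈ AA g f (q+1) :=
  Algebra.subset_adjoin (Or.inr ⟨i, h, rfl⟩)

theorem gens_mono (q : ℕ) : gens g f q ⊆ gens g f (q+1) := by
  cases q with
  | zero => simp [gens]
  | succ q =>
    rintro z (hz | ⟨i, hi, rfl⟩)
    · exact Or.inl hz
    · exact Or.inr ⟨i, Nat.lt_succ_of_lt hi, rfl⟩

theorem AA_mono (q : ℕ) : AA g f q ≤ AA g f (q+1) := Algebra.adjoin_mono (gens_mono q)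

theorem tt_mem (q : ℕ) : tt g f q ∈ AA g f (q+1) := by
  induction q with
  | zero => exact mul_mem (mul_mem (g_mem _ _) (g_mem _ _)) (g_mem _ _)
  | succ q ih =>
    exact mul_mem (mul_mem (f_mem (Nat.lt_succ_self q)) (AA_mono _ ih)) (f_mem (Nat.lt_succ_self q))

theorem comm_AA (h : Rels g f) (q : ℕ) {z : R} (hz : z ∈ AA g f q) : f q * z = z * f q := by
  have hle : AA g f q ≤ Subalgebra.centralizer ℚ {f q} := by
    apply Algebra.adjoin_le
    intro z hz
    rw [SetLike.mem_coe, Subalgebra.mem_centralizer_iff]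
    intro y hy
    rw [Set.mem_singleton_iff] at hy
    subst hy
    cases q with
    | zero => simp [gens] at hz
    | succ q =>
      rcases hz with ⟨t, rfl⟩ | ⟨i, hi, rfl⟩
      · exact (h.gf t q).symm
      · exact (h.fcomm i (q+1) (by have : i < q := hi; omega)).symm
  have := hle hz
  rw [Subalgebra.mem_centralizer_iff] at this
  exact this _ rfl

theorem TT1 {q : ℕ} {z : R} (hz : z ∈ AA g f (q+1)) : z ∈ TT g f q :=
  Submodule.subset_span (Or.inl hz)

theorem TT2 {q : ℕ} {u v : R} (hu : u ∈ AA g f (q+1)) (hv : v ∈ AA g f (q+1)) :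
    u * f q * v ∈ TT g f q :=
  Submodule.subset_span (Or.inr (Or.inl ⟨u, hu, v, hv, rfl⟩))

theorem TT3 {q : ℕ} {u : R} (hu : u ∈ AA g f (q+1)) :
    u * tt g f (q+1) ∈ TT g f q :=
  Submodule.subset_span (Or.inr (Or.inr ⟨u, hu, rfl⟩))

theorem TT_left {q : ℕ} {u : R} (hu : u ∈ AA g f (q+1)) : ∀ z ∈ TT g f q, u * z ∈ TT g f q := by
  apply span_mul_left
  rintro z (hz | ⟨a, ha, b, hb, rfl⟩ | ⟨a, ha, rfl⟩)
  · exact TT1 (mul_mem hu hz)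
  · have := TT2 (mul_mem hu ha) hb
    simpa only [mul_assoc] using this
  · have := TT3 (mul_mem hu ha)
    simpa only [mul_assoc] using this

/-- The six words in the two generators at the fork. -/
def wz (g : Bool → R) : Unit ⊕ Bool ⊕ Bool ⊕ Unit → R
  | .inl _ => 1
  | .inr (.inl t) => g t
  | .inr (.inr (.inl t)) => g t * g (!t)
  | .inr (.inr (.inr _)) => g false * g true * g false

theorem AA_one_le (h : Rels g f) :
    Subalgebra.toSubmodule (AA g f 1) ≤ Submodule.span ℚ (Set.range (wz g)) := by
  have w : ∀ i, wz g i ∈ Submodule.span ℚ (Set.range (wz g)) :=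
    fun i => Submodule.subset_span ⟨i, rfl⟩
  have w1 : (1 : R) ∈ Submodule.span ℚ (Set.range (wz g)) := w (.inl ())
  have w2 : ∀ t, g t ∈ Submodule.span ℚ (Set.range (wz g)) := fun t => w (.inr (.inl t))
  have w3 : ∀ t, g t * g (!t) ∈ Submodule.span ℚ (Set.range (wz g)) :=
    fun t => w (.inr (.inr (.inl t)))
  have w4 : ∀ t, g t * g (!t) * g t ∈ Submodule.span ℚ (Set.range (wz g)) := by
    have := w (.inr (.inr (.inr ())))
    intro t
    cases t
    · exact this
    · rw [h.gbr]; exact Submodule.neg_mem _ this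
  apply adjoin_le_of_right _ _ w1
  intro z hz s hs
  simp only [gens, not_lt_zero, Set.ofPred_false, Set.image_empty, Set.union_empty,
    Set.mem_range] at hs
  obtain ⟨t, rfl⟩ := hs
  revert z
  apply span_mul_right
  rintro _ ⟨i, rfl⟩
  have key : ∀ t s : Bool, s = t ∨ s = !t := by decide
  rcases i with _ | t' | t' | _
  · simpa [wz] using w2 t
  · rcases key t' t with rfl | rfl
    · simp [wz, h.gg]
    · exact w3 t'
  · rcases key t' t with rfl | rfl
    · exact w4 _
    · simp [wz, mul_assoc, h.gg]
  · cases t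
    · simp [wz, mul_assoc, h.gg]
    · have := h.gbr false
      simp only [Bool.not_false] at this
      simp [wz, this, mul_assoc, h.gg]

theorem Z_zero (h : Rels g f) : ∀ z ∈ AA g f 1, f 0 * z * f 0 ∈ TT g f 0 := by
  intro z hz
  have hz' := AA_one_le h hz
  have : ∀ z ∈ Submodule.span ℚ (Set.range (wz g)), f 0 * z ∈
      (TT g f 0).comap (LinearMap.mulRight ℚ (f 0)) := by
    apply span_mul_left
    rintro _ ⟨i, rfl⟩
    simp only [Submodule.mem_comap, LinearMap.mulRight_apply]
    rcases i with _ | t | t | _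
    · simp [wz, h.ff]
    · have := TT2 (g := g) (f := f) (g_mem t 0) (g_mem t 0)
      rw [h.gfbr] at this
      simpa [wz] using this
    · have h1 := TT2 (g := g) (f := f) (mul_mem (g_mem t 0) (g_mem (!t) 0)) (g_mem t 0)
      have h2 := TT2 (g := g) (f := f) (g_mem (!t) 0) (mul_mem (g_mem t 0) (g_mem (!t) 0))
      have := h.claw t
      simp only [wz]
      rw [← mul_assoc, this]
      apply Submodule.sub_mem _ (Submodule.neg_mem _ h1)
      simpa only [mul_assoc] using h2
    · have := TT3 (g := g) (f := f) (q := 0) (one_mem _)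
      simpa [wz, tt] using this
  exact this z hz'

theorem ttg_zero (h : Rels g f) (t : Bool) : tt g f 1 * g t = g (!t) * tt g f 1 := by
  have h0 : tt g f 0 = (if t then -1 else 1) * (g t * g (!t) * g t) := by
    cases t
    · simp [tt]
    · rw [h.gbr]; simp [tt]
  have e1 : f 0 * (g t * g (!t) * g t) * f 0 * g t = g (!t) * (f 0 * (g t * g (!t) * g t) * f 0) := by
    calc f 0 * (g t * g (!t) * g t) * f 0 * g t
        = f 0 * g t * g (!t) * (g t * f 0 * g t) := by noncomm_ring
      _ = - (f 0 * g t * g (!t) * f 0) * g t * f 0 := by rw [h.gfbr]; noncomm_ring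
      _ = g t * g (!t) * f 0 * (g t * g t) * f 0
          + g (!t) * f 0 * g t * g (!t) * g t * f 0 := by rw [h.claw]; noncomm_ring
      _ = _ := by rw [h.gg]; noncomm_ring
  simp only [tt] at h0 ⊢
  rw [h0]
  cases t
  · simpa using e1
  · simpa using e1

theorem main_step (h : Rels g f) (q : ℕ) (Z : ∀ z ∈ AA g f (q+1), f q * z * f q ∈ TT g f q)
    (T : ∀ s ∈ gens g f (q+1), tt g f (q+1) * s ∈ TT g f q) :
    Subalgebra.toSubmodule (AA g f (q+2)) ≤ TT g f q := by
  apply adjoin_le_of_right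
  · exact TT1 (one_mem _)
  intro z hz s hs
  have hs' : s ∈ gens g f (q+1) ∨ s = f q := by
    rcases hs with hs | ⟨i, hi, rfl⟩
    · exact Or.inl (Or.inl hs)
    · rcases Nat.lt_succ_iff_lt_or_eq.1 hi with hi | rfl
      · exact Or.inl (Or.inr ⟨i, hi, rfl⟩)
      · exact Or.inr rfl
  revert z
  apply span_mul_right
  rcases hs' with hs' | rfl
  · have hsA : s ∈ AA g f (q+1) := Algebra.subset_adjoin hs'
    rintro z (hz | ⟨a, ha, b, hb, rfl⟩ | ⟨a, ha, rfl⟩)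
    · exact TT1 (mul_mem hz hsA)
    · rw [mul_assoc]; exact TT2 ha (mul_mem hb hsA)
    · rw [mul_assoc]; exact TT_left ha _ (T _ hs')
  · rintro z (hz | ⟨a, ha, b, hb, rfl⟩ | ⟨a, ha, rfl⟩)
    · simpa using TT2 hz (one_mem _)
    · have := TT_left ha _ (Z b hb)
      simpa only [mul_assoc] using this
    · simp [tt, mul_assoc, h.ff]

theorem main_le (h : Rels g f) (q : ℕ) :
    Subalgebra.toSubmodule (AA g f (q+2)) ≤ TT g f q := by
  induction q with
  | zero =>
    apply main_step h 0 (Z_zero h)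
    intro s hs
    simp only [gens, not_lt_zero, Set.ofPred_false, Set.image_empty, Set.union_empty,
      Set.mem_range] at hs
    obtain ⟨t, rfl⟩ := hs
    rw [ttg_zero h]
    exact TT3 (g_mem _ _)
  | succ q ih =>
    have Z : ∀ z ∈ AA g f (q+2), f (q+1) * z * f (q+1) ∈ TT g f (q+1) := by
      intro z hz
      have hz' := ih hz
      have : ∀ z ∈ TT g f q, f (q+1) * z ∈
          (TT g f (q+1)).comap (LinearMap.mulRight ℚ (f (q+1))) := by
        apply span_mul_left
        rintro z (hz | ⟨a, ha, b, hb, rfl⟩ | ⟨a, ha, rfl⟩)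
        · simp [comm_AA h _ hz, mul_assoc, h.ff]
        · simp only [Submodule.mem_comap, LinearMap.mulRight_apply]
          have e : f (q+1) * (a * f q * b) * f (q+1) = a * f q * f (q+1) * (f q * b) := by
            calc f (q+1) * (a * f q * b) * f (q+1)
                = (f (q+1) * a) * f q * (b * f (q+1)) := by noncomm_ring
              _ = a * (f (q+1) * f q * f (q+1)) * b := by
                  rw [comm_AA h _ ha, ← comm_AA h _ hb]; noncomm_ring
              _ = _ := by rw [← h.fbr]; noncomm_ring
          rw [e]
          exact TT2 (mul_mem (AA_mono _ ha) (f_mem (Nat.lt_succ_self q)))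
            (mul_mem (f_mem (Nat.lt_succ_self q)) (AA_mono _ hb))
        · simp only [Submodule.mem_comap, LinearMap.mulRight_apply]
          have e : f (q+1) * (a * tt g f (q+1)) * f (q+1) = a * tt g f (q+1+1) := by
            rw [← mul_assoc, comm_AA h _ ha]
            simp only [tt]; noncomm_ring
          rw [e]
          exact TT3 (AA_mono _ ha)
      exact this z hz'
    apply main_step h _ Z
    intro s hs
    have hs' : s ∈ gens g f (q+1) ∨ s = f q := by
      rcases hs with hs | ⟨i, hi, rfl⟩
      · exact Or.inl (Or.inl hs)
      · rcases Nat.lt_succ_iff_lt_or_eq.1 hi with hi | rfl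
        · exact Or.inl (Or.inr ⟨i, hi, rfl⟩)
        · exact Or.inr rfl
    rcases hs' with hs' | rfl
    · have hsA : s ∈ AA g f (q+1) := Algebra.subset_adjoin hs'
      have := Z _ (mul_mem (tt_mem (q+1)) (AA_mono _ hsA))
      have e : f (q+1) * (tt g f (q+1) * s) * f (q+1) = tt g f (q+1+1) * s := by
        rw [mul_assoc, mul_assoc, ← comm_AA h _ hsA]
        simp only [tt]; noncomm_ring
      rw [← e]; exact this
    · have e : tt g f (q+1+1) * f q = f q * tt g f (q+1+1) := by
        have c := comm_AA h _ (tt_mem (g := g) (f := f) q)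
        simp only [tt]
        calc f (q+1) * (f q * tt g f q * f q) * f (q+1) * f q
            = f (q+1) * f q * tt g f q * (f q * f (q+1) * f q) := by noncomm_ring
          _ = f (q+1) * f q * (tt g f q * f (q+1)) * f q * f (q+1) := by
              rw [h.fbr]; noncomm_ring
          _ = (f (q+1) * f q * f (q+1)) * tt g f q * f q * f (q+1) := by
              rw [← c]; noncomm_ring
          _ = _ := by rw [← h.fbr]; noncomm_ring
      rw [e]
      exact TT3 (f_mem (Nat.lt_succ_self q))
end Upper

section Basis
open Polynomial
variable {R : Type*} [Ring R] [Algebra ℚ R] {g : Bool → R} {f : ℕ → R}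

structure Gr (dS : ℕ → Submodule ℚ R) : Prop where
  one : (1 : R) ∈ dS 0
  mul : ∀ {i j a b}, a ∈ dS i → b ∈ dS j → a * b ∈ dS (i + j)

theorem qint_succ (k : ℕ) : qint (k+1) = qint k + X ^ k := by
  simp [qint, Finset.sum_range_succ]

theorem qint_succ' (k : ℕ) : qint (k+1) = 1 + X * qint k := by
  simp [qint, Finset.sum_range_succ', Finset.mul_sum, pow_succ', add_comm]

theorem qint_two_mul (k : ℕ) : qint (2 * k) = qint k * (1 + X ^ k) := by
  simp only [qint, two_mul, Finset.sum_range_add, mul_add, mul_one, Finset.sum_mul, pow_add]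
  congr 1
  exact Finset.sum_congr rfl fun i _ => mul_comm _ _

def WData (dS : ℕ → Submodule ℚ R) (g : Bool → R) (f : ℕ → R) (q : ℕ) : Prop :=
  ∃ (κ : Type) (_ : Fintype κ) (deg : κ → ℕ) (w r : κ → R),
    (∀ k, w k ∈ dS (deg k)) ∧ (∀ k, w k ∈ AA g f (q+1)) ∧
    (∀ k, ∃ e, deg k + e = 2 * q + 3 ∧ r k ∈ dS e) ∧ (∀ k, w k * r k = tt g f q) ∧
    (∀ k l, k ≠ l → deg k = deg l → w l * r k = 0) ∧
    (∑ k, (X : ℕ[X]) ^ deg k = qint (q+3) * (1 + X ^ (q+1))) ∧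
    Subalgebra.toSubmodule (AA g f (q+1)) ≤
      Subalgebra.toSubmodule (AA g f q) * Submodule.span ℚ (Set.range w)

theorem tt_deg {dS : ℕ → Submodule ℚ R} (hG : Gr dS) (hg : ∀ t, g t ∈ dS 1)
    (hf : ∀ i, f i ∈ dS 1) (q : ℕ) : tt g f q ∈ dS (2 * q + 3) := by
  induction q with
  | zero => exact hG.mul (i := 2) (hG.mul (hg _) (hg _)) (hg _)
  | succ q ih =>
    have := hG.mul (hG.mul (hf q) ih) (hf q)
    rw [show 1 + (2 * q + 3) + 1 = 2 * (q+1) + 3 by ring] at this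
    exact this

theorem wData (h : Rels g f) {dS : ℕ → Submodule ℚ R} (hG : Gr dS) (hg : ∀ t, g t ∈ dS 1)
    (hf : ∀ i, f i ∈ dS 1) (q : ℕ) : WData dS g f q := by
  induction q with
  | zero =>
    refine ⟨Unit ⊕ Bool ⊕ Bool ⊕ Unit, inferInstance,
      Sum.elim (fun _ => 0) (Sum.elim (fun _ => 1) (Sum.elim (fun _ => 2) (fun _ => 3))), wz g,
      Sum.elim (fun _ => tt g f 0) (Sum.elim
        (fun t => if t then - (g false * g true) else g true * g false)
        (Sum.elim (fun t => if t then - g true else g false) (fun _ => 1))), ?_, ?_, ?_, ?_, ?_, ?_, ?_⟩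
    · rintro (_ | t | t | _)
      · exact hG.one
      · exact hg t
      · exact hG.mul (hg _) (hg _)
      · exact hG.mul (hG.mul (hg _) (hg _)) (hg _)
    · rintro (_ | t | t | _)
      · exact one_mem _
      · exact g_mem _ _
      · exact mul_mem (g_mem _ _) (g_mem _ _)
      · exact mul_mem (mul_mem (g_mem _ _) (g_mem _ _)) (g_mem _ _)
    · rintro (_ | t | t | _)
      · exact ⟨3, rfl, tt_deg hG hg hf 0⟩
      · refine ⟨2, rfl, ?_⟩
        cases t
        · exact hG.mul (hg true) (hg false)
        · exact Submodule.neg_mem _ (hG.mul (hg false) (hg true))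
      · refine ⟨1, rfl, ?_⟩
        cases t
        · exact hg false
        · exact Submodule.neg_mem _ (hg true)
      · exact ⟨0, rfl, hG.one⟩
    · have hb := h.gbr true
      rintro (_ | t | t | _)
      · simp [wz]
      · cases t
        · simp [wz, tt, mul_assoc]
        · have hb' := congrArg Neg.neg hb
          simp only [Bool.not_true, neg_neg] at hb'
          simp [wz, tt, ← mul_assoc, hb']
      · cases t
        · simp [wz, tt]
        · have hb' := congrArg Neg.neg hb
          simp only [Bool.not_true, neg_neg] at hb'
          simp [wz, tt, hb']
      · simp [wz, tt]
    · rintro (_ | t | t | _) (_ | t' | t' | _) hne hd <;>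
        first
          | (exfalso; revert hd; simp; done)
          | (exfalso; exact hne rfl)
          | (cases t <;> cases t' <;>
              first
                | (exfalso; exact hne rfl)
                | (simp [wz, ← mul_assoc, h.gg]; done)
                | (simp [wz, mul_assoc, h.gg]; done))
    · simp [qint, Finset.sum_range_succ]
      ring
    · refine (AA_one_le h).trans ?_
      intro z hz
      have := Submodule.mul_mem_mul (M := Subalgebra.toSubmodule (AA g f 0)) (one_mem (AA g f 0)) hz
      rwa [one_mul] at this
  | succ q ih =>
    obtain ⟨κ, _, deg, w, r, h1, h2, h3, h4, h5, h6, h7⟩ := ih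
    have hdeg : ∀ k, deg k ≤ 2 * q + 3 := fun k => by
      obtain ⟨e, he, -⟩ := h3 k; omega
    refine ⟨Option (Option κ), inferInstance,
      fun k => k.elim 0 (fun k => k.elim (2 * q + 5) (fun k => deg k + 1)),
      fun k => k.elim 1 (fun k => k.elim (tt g f (q+1)) (fun k => f q * w k)),
      fun k => k.elim (tt g f (q+1)) (fun k => k.elim 1 (fun k => r k * f q)), ?_, ?_, ?_, ?_, ?_, ?_, ?_⟩
    · rintro (_ | _ | k)
      · exact hG.one
      · exact tt_deg hG hg hf (q+1)
      · have := hG.mul (hf q) (h1 k)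
        rw [add_comm] at this
        exact this
    · rintro (_ | _ | k)
      · exact one_mem _
      · exact tt_mem (q+1)
      · exact mul_mem (f_mem (Nat.lt_succ_self q)) (AA_mono _ (h2 k))
    · rintro (_ | _ | k)
      · exact ⟨2 * (q+1) + 3, by simp, tt_deg hG hg hf (q+1)⟩
      · exact ⟨0, by simp; ring, hG.one⟩
      · obtain ⟨e, he, hr⟩ := h3 k
        exact ⟨e + 1, by simp; omega, hG.mul hr (hf q)⟩
    · rintro (_ | _ | k)
      · simp
      · simp
      · have := h4 k
        simp only [Option.elim, tt]
        rw [← this]; noncomm_ring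
    · rintro (_ | _ | k) (_ | _ | l) hne hd <;> simp only [Option.elim] at hd ⊢
      · exact absurd rfl hne
      · omega
      · omega
      · omega
      · exact absurd rfl hne
      · have := hdeg l; omega
      · omega
      · have := hdeg k; omega
      · have := h5 k l (by rintro rfl; exact hne rfl) (by omega)
        rw [show f q * w l * (r k * f q) = f q * (w l * r k) * f q by noncomm_ring, this]
        simp
    · rw [Fintype.sum_option, Fintype.sum_option]
      simp only [Option.elim, pow_succ (X : ℕ[X]) (deg _)]
      rw [← Finset.sum_mul, h6]
      have e1 := qint_succ (q+3)
      have e2 := qint_succ' (q+3)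
      calc X ^ 0 + (X ^ (2 * q + 5) + qint (q+3) * (1 + X ^ (q+1)) * X)
          = (1 + X * qint (q+3)) + X ^ (q+2) * (qint (q+3) + X ^ (q+3)) := by ring
        _ = _ := by rw [← e1, ← e2]; ring
    · refine (main_le h q).trans ?_
      set M := Subalgebra.toSubmodule (AA g f (q+1)) * Submodule.span ℚ (Set.range
        (fun k : Option (Option κ) => k.elim 1 (fun k => k.elim (tt g f (q+1)) (fun k => f q * w k))))
        with hM
      have m : ∀ u ∈ AA g f (q+1), ∀ k : Option (Option κ),
          u * (k.elim 1 (fun k => k.elim (tt g f (q+1)) (fun k => f q * w k))) ∈ M :=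
        fun u hu k => Submodule.mul_mem_mul hu (Submodule.subset_span ⟨k, rfl⟩)
      rw [TT, Submodule.span_le]
      rintro z (hz | ⟨u, hu, v, hv, rfl⟩ | ⟨u, hu, rfl⟩)
      · simpa using m z hz none
      · have hv' := h7 hv
        have hle : Subalgebra.toSubmodule (AA g f q) * Submodule.span ℚ (Set.range w) ≤
            M.comap (LinearMap.mulLeft ℚ (u * f q)) := by
          rw [Submodule.mul_le]
          intro a ha b hb
          have ha' : a ∈ AA g f q := ha
          have e : u * f q * (a * b) = (u * a * f q) * b := by
            rw [mul_assoc u a, ← comm_AA h q ha']; noncomm_ring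
          simp only [Submodule.mem_comap, LinearMap.mulLeft_apply]
          rw [e]
          clear e
          revert b
          apply span_mul_left
          rintro _ ⟨k, rfl⟩
          have := m (u * a) (mul_mem hu (AA_mono _ ha')) (some (some k))
          simpa only [mul_assoc, Option.elim] using this
        exact hle hv'
      · exact m u hu (some none)

theorem indep {ι κ : Type} [Fintype ι] [Fintype κ] {A : Subalgebra ℚ R}
    {dS : ℕ → Submodule ℚ R} (hG : Gr dS) {v : ι → R} (hv : LinearIndependent ℚ v)
    (hvA : ∀ i, v i ∈ A) {deg : κ → ℕ} {w r : κ → R} {N : ℕ} {t : R} (D : R →ₗ[ℚ] R)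
    (hD : ∀ u ∈ A, ∀ z, D (u * z) = u * D z) (hK : ∀ d < N, ∀ z ∈ dS d, D z = 0) (ht : D t = 1)
    (h1 : ∀ k, w k ∈ dS (deg k)) (h3 : ∀ k, ∃ e, deg k + e = N ∧ r k ∈ dS e)
    (h4 : ∀ k, w k * r k = t) (h5 : ∀ k l, k ≠ l → deg k = deg l → w l * r k = 0) :
    LinearIndependent ℚ (fun p : ι × κ => v p.1 * w p.2) := by
  rw [Fintype.linearIndependent_iff] at hv ⊢
  intro c hc
  set F : κ → R := fun k => ∑ i, c (i, k) • v i with hF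
  have hFA : ∀ k, F k ∈ A := fun k => sum_mem fun i _ => A.smul_mem (hvA i) _
  have hs : ∑ k, F k * w k = 0 := by
    rw [← hc, Fintype.sum_prod_type_right]
    refine Finset.sum_congr rfl fun k _ => ?_
    simp only [hF, Finset.sum_mul, smul_mul_assoc]
  have hF0 : ∀ m k, N - deg k < m → F k = 0 := by
    intro m
    induction m with
    | zero => intro k hk; omega
    | succ m ih =>
      intro k hk
      have e : D ((∑ l, F l * w l) * r k) = F k := by
        rw [Finset.sum_mul, map_sum, Finset.sum_eq_single k]
        · rw [mul_assoc, h4, hD _ (hFA k), ht, mul_one]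
        · intro l _ hl
          obtain ⟨e, he, hr⟩ := h3 k
          obtain ⟨e', he', -⟩ := h3 l
          rcases lt_trichotomy (deg l) (deg k) with hlt | heq | hgt
          · rw [mul_assoc, hD _ (hFA l), hK (deg l + e) (by omega) _ (hG.mul (h1 l) hr), mul_zero]
          · rw [mul_assoc, h5 k l (Ne.symm hl) heq.symm]; simp
          · rw [ih l (by omega)]; simp
        · simp
      rw [← e, hs]; simp
  rintro ⟨i, k⟩
  exact hv (fun i => c (i, k)) (hF0 _ k (Nat.lt_succ_self _)) i

theorem basis_exists [Nontrivial R] (h : Rels g f) {dS : ℕ → Submodule ℚ R} (hG : Gr dS)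
    (hg : ∀ t, g t ∈ dS 1) (hf : ∀ i, f i ∈ dS 1) (Q : ℕ)
    (hD : ∀ q < Q, ∃ D : R →ₗ[ℚ] R, (∀ u ∈ AA g f q, ∀ z, D (u * z) = u * D z) ∧
      (∀ d < 2 * q + 3, ∀ z ∈ dS d, D z = 0) ∧ D (tt g f q) = 1) :
    ∃ (ι : Type) (_ : Fintype ι) (deg : ι → ℕ) (v : ι → R),
      LinearIndependent ℚ v ∧ (∀ i, v i ∈ dS (deg i)) ∧
      Submodule.span ℚ (Set.range v) = Subalgebra.toSubmodule (AA g f Q) ∧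
      ∑ i, (X : ℕ[X]) ^ deg i = ∏ q ∈ Finset.range Q, (qint (q+3) * (1 + X ^ (q+1))) := by
  induction Q with
  | zero =>
    refine ⟨Unit, inferInstance, fun _ => 0, fun _ => 1, ?_, fun _ => hG.one, ?_, by simp⟩
    · exact LinearIndependent.of_subsingleton () one_ne_zero
    · simp [AA, gens, Algebra.toSubmodule_bot, Submodule.one_eq_span]
  | succ Q ih =>
    obtain ⟨ι, _, deg, v, hv, hvd, hvs, hvX⟩ := ih fun q hq => hD q (Nat.lt_succ_of_lt hq)
    obtain ⟨κ, _, degw, w, r, h1, h2, h3, h4, h5, h6, h7⟩ := wData h hG hg hf Q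
    obtain ⟨D, hD1, hD2, hD3⟩ := hD Q (Nat.lt_succ_self Q)
    have hvA : ∀ i, v i ∈ AA g f Q := fun i => by
      have : v i ∈ Submodule.span ℚ (Set.range v) := Submodule.subset_span ⟨i, rfl⟩
      rwa [hvs] at this
    refine ⟨ι × κ, inferInstance, fun p => deg p.1 + degw p.2, fun p => v p.1 * w p.2,
      indep hG hv hvA D hD1 hD2 hD3 h1 h3 h4 h5, fun p => hG.mul (hvd _) (h1 _), ?_, ?_⟩
    · apply le_antisymm
      · rw [Submodule.span_le]
        rintro _ ⟨p, rfl⟩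
        exact (AA g f (Q+1)).mul_mem (AA_mono _ (hvA _)) (h2 _)
      · refine h7.trans ?_
        rw [← hvs, Submodule.span_mul_span]
        apply Submodule.span_mono
        rintro _ ⟨_, ⟨i, rfl⟩, _, ⟨k, rfl⟩, rfl⟩
        exact ⟨(i, k), rfl⟩
    · rw [Finset.prod_range_succ, ← hvX, ← h6, Fintype.sum_prod_type, Finset.sum_mul_sum]
      simp only [pow_add]

end Basis

section Model
variable {n : ℕ}

structure FKRels {B : Type*} [Ring B] (φ : Fin n → Fin n → B) : Prop where
  diag : ∀ i, φ i i = 0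
  antisymm : ∀ i j, i ≠ j → φ j i = - φ i j
  square : ∀ i j, i ≠ j → φ i j * φ i j = 0
  comm : ∀ i j k l, List.Nodup [i, j, k, l] → φ i j * φ k l = φ k l * φ i j
  cyclic : ∀ i j k, List.Nodup [i, j, k] → φ i j * φ j k + φ j k * φ k i + φ k i * φ i j = 0

noncomputable def liftE {B : Type*} [Ring B] [Algebra ℚ B] (φ : Fin n → Fin n → B)
    (h : FKRels φ) : E n →ₐ[ℚ] B :=
  RingQuot.liftAlgHom ℚ ⟨FreeAlgebra.lift ℚ (fun p => φ p.1 p.2), by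
    intro a b hab
    cases hab with
    | diag i => simp [h.diag]
    | antisymm i j hij => simp [h.antisymm i j hij]
    | square i j hij => simp [h.square i j hij]
    | comm i j k l hh => simp [h.comm i j k l hh]
    | cyclic i j k hh => simp [h.cyclic i j k hh]⟩

theorem liftE_x {B : Type*} [Ring B] [Algebra ℚ B] (φ : Fin n → Fin n → B)
    (h : FKRels φ) (i j : Fin n) : liftE φ h (x n i j) = φ i j := by
  simp [liftE, x]

theorem x_rels : FKRels (x n) where
  diag i := by
    have := RingQuot.mkAlgHom_rel ℚ (Rel.diag (n := n) i)
    simpa [x] using this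
  antisymm i j hij := by
    have := RingQuot.mkAlgHom_rel ℚ (Rel.antisymm (n := n) i j hij)
    simpa [x] using this
  square i j hij := by
    have := RingQuot.mkAlgHom_rel ℚ (Rel.square (n := n) i j hij)
    simpa [x] using this
  comm i j k l h := by
    have := RingQuot.mkAlgHom_rel ℚ (Rel.comm (n := n) i j k l h)
    simpa [x] using this
  cyclic i j k h := by
    have := RingQuot.mkAlgHom_rel ℚ (Rel.cyclic (n := n) i j k h)
    simpa [x] using this

instance E_nontrivial : Nontrivial (E n) := by
  have h : FKRels (fun _ _ : Fin n => (0 : ℚ)) := by constructor <;> simp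
  exact (liftE _ h).toRingHom.domain_nontrivial

theorem perm_rels {B : Type*} [Ring B] {φ : Fin n → Fin n → B} (h : FKRels φ)
    (σ : Equiv.Perm (Fin n)) : FKRels (fun i j => φ (σ i) (σ j)) where
  diag i := h.diag _
  antisymm i j hh := h.antisymm _ _ (σ.injective.ne hh)
  square i j hh := h.square _ _ (σ.injective.ne hh)
  comm i j k l hh := h.comm _ _ _ _ (by simpa using hh)
  cyclic i j k hh := h.cyclic _ _ _ (by simpa using hh)

noncomputable def sE (σ : Equiv.Perm (Fin n)) : E n →ₐ[ℚ] E n := liftE _ (perm_rels x_rels σ)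

theorem sE_x (σ : Equiv.Perm (Fin n)) (i j : Fin n) : sE σ (x n i j) = x n (σ i) (σ j) :=
  liftE_x _ _ _ _

def delR (B : Type*) [Ring B] (p q i j : Fin n) : B :=
  if i = p ∧ j = q then 1 else if i = q ∧ j = p then -1 else 0

theorem mat_rels {B : Type*} [Ring B] {φ : Fin n → Fin n → B} (hx : FKRels φ)
    (p q : Fin n) (hpq : p ≠ q) : FKRels (fun i j : Fin n =>
    !![φ i j, delR B p q i j; 0, φ (Equiv.swap p q i) (Equiv.swap p q j)]) := by
  have hs := perm_rels hx (Equiv.swap p q)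
  have z : (0 : Matrix (Fin 2) (Fin 2) (B)) = !![0, 0; 0, 0] := by
    ext i j; fin_cases i <;> fin_cases j <;> rfl
  constructor
  · intro i
    have : delR B p q i i = 0 := by
      unfold delR
      rw [if_neg, if_neg] <;> rintro ⟨rfl, h⟩ <;> exact hpq (by simp [h])
    simp only [hx.diag, this, z]
  · intro i j hij
    have : delR B p q j i = - delR B p q i j := by
      unfold delR
      by_cases h1 : i = p ∧ j = q
      · obtain ⟨rfl, rfl⟩ := h1
        simp [hij, hij.symm]
      · by_cases h2 : i = q ∧ j = p
        · obtain ⟨rfl, rfl⟩ := h2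
          simp [hij]
        · rw [if_neg (fun h => h2 ⟨h.2, h.1⟩), if_neg (fun h => h1 ⟨h.2, h.1⟩), if_neg h1, if_neg h2]
          simp
    have h2 := hs.antisymm i j hij
    rw [hx.antisymm i j hij, this, h2]
    ext a b; fin_cases a <;> fin_cases b <;> simp
  · intro i j hij
    have h2 := hs.square i j hij
    simp only [Matrix.mul_fin_two, hx.square i j hij, h2, z, mul_zero, zero_mul, add_zero, zero_add]
    congr 3
    have : φ i j * delR B p q i j + delR B p q i j * φ (Equiv.swap p q i) (Equiv.swap p q j) = 0 := by
      clear h2 hs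
      unfold delR
      split_ifs with h1 h1
      · obtain ⟨rfl, rfl⟩ := h1
        simp [hx.antisymm _ _ hij]
      · obtain ⟨rfl, rfl⟩ := h1
        simp [hx.antisymm _ _ hij]
      · simp
    rw [this]
  · intro i j k l h
    have h2 := hs.comm i j k l h
    simp only [Matrix.mul_fin_two, hx.comm i j k l h, h2, mul_zero, zero_mul, add_zero, zero_add]
    simp only [List.nodup_cons, List.mem_cons, List.not_mem_nil, or_false, not_or,
      not_false_eq_true, List.nodup_nil, and_true] at h
    obtain ⟨⟨hij, hik, hil⟩, ⟨hjk, hjl⟩, hkl⟩ := h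
    congr 3
    clear h2 hs
    have : φ i j * delR B p q k l + delR B p q i j * φ (Equiv.swap p q k) (Equiv.swap p q l)
      = φ k l * delR B p q i j + delR B p q k l * φ (Equiv.swap p q i) (Equiv.swap p q j) := by
      unfold delR
      by_cases h1 : i = p <;> by_cases h2 : i = q <;> by_cases h3 : j = p <;> by_cases h4 : j = q <;>
      by_cases h5 : k = p <;> by_cases h6 : k = q <;> by_cases h7 : l = p <;> by_cases h8 : l = q <;>
      first
        | (exfalso; subst_vars; simp_all; done)
        | simp_all [Equiv.swap_apply_def]
    rw [this]
  · intro i j k h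
    have h2 := hs.cyclic i j k h
    have h1 := hx.cyclic i j k h
    simp only [List.nodup_cons, List.mem_cons, List.not_mem_nil, or_false, not_or,
      not_false_eq_true, List.nodup_nil, and_true] at h
    obtain ⟨⟨hij, hik⟩, hjk⟩ := h
    have a1 := hx.antisymm i j hij
    have a2 := hx.antisymm j k hjk
    have a3 := hx.antisymm i k hik
    have : (φ i j * delR B p q j k + delR B p q i j * φ (Equiv.swap p q j) (Equiv.swap p q k))
      + (φ j k * delR B p q k i + delR B p q j k * φ (Equiv.swap p q k) (Equiv.swap p q i))
      + (φ k i * delR B p q i j + delR B p q k i * φ (Equiv.swap p q i) (Equiv.swap p q j)) = 0 := by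
      clear h1 h2 hs hx
      unfold delR
      by_cases h1 : i = p <;> by_cases h2 : i = q <;> by_cases h3 : j = p <;> by_cases h4 : j = q <;>
      by_cases h5 : k = p <;> by_cases h6 : k = q <;>
      first
        | (exfalso; subst_vars; simp_all; done)
        | (simp_all [Equiv.swap_apply_def]; done)
        | (simp [*, Equiv.swap_apply_def]; done)
        | (subst_vars; simp_all [Equiv.swap_apply_def]; done)
    ext a b
    have t1 : ∀ A B : B, A = 0 → B = 0 → A = B := fun A B h h' => h.trans h'.symm
    fin_cases a <;> fin_cases b <;> simp [Matrix.mul_fin_two, h1, h2]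
    simpa using this

end Model

section Skew
variable {R : Type*} [Ring R] [Algebra ℚ R]

def Low (dS : ℕ → Submodule ℚ R) (k : ℕ) (D : R →ₗ[ℚ] R) : Prop :=
  ∀ d, ∀ z ∈ dS d, (d < k → D z = 0) ∧ (k ≤ d → D z ∈ dS (d - k))

theorem Low.comp {dS : ℕ → Submodule ℚ R} {k l : ℕ} {D D' : R →ₗ[ℚ] R} (h : Low dS k D)
    (h' : Low dS l D') : Low dS (k + l) (D' ∘ₗ D) := by
  intro d z hz
  obtain ⟨h1, h2⟩ := h d z hz
  rcases lt_or_ge d k with hd | hd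
  · refine ⟨fun _ => by simp [h1 hd], fun hh => by omega⟩
  · obtain ⟨h3, h4⟩ := h' _ _ (h2 hd)
    refine ⟨fun hh => by simpa using h3 (by omega), fun hh => ?_⟩
    have := h4 (by omega)
    rwa [Nat.sub_sub] at this

theorem Low.neg {dS : ℕ → Submodule ℚ R} {k : ℕ} {D : R →ₗ[ℚ] R} (h : Low dS k D) :
    Low dS k (-D) := by
  intro d z hz
  obtain ⟨h1, h2⟩ := h d z hz
  exact ⟨fun hd => by simp [h1 hd], fun hd => by simpa using h2 hd⟩

structure Sk (y : ℕ → ℕ → R) (dS : ℕ → Submodule ℚ R) (p N : ℕ) (Δ : R →ₗ[ℚ] R)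
    (s : R →ₐ[ℚ] R) : Prop where
  leib : ∀ u v, Δ (u * v) = u * Δ v + Δ u * s v
  y1 : Δ (y p N) = 1
  y2 : Δ (y N p) = -1
  y0 : ∀ i j, ¬ (i = p ∧ j = N) → ¬ (i = N ∧ j = p) → Δ (y i j) = 0
  sy : ∀ i j, s (y i j) = y (Equiv.swap p N i) (Equiv.swap p N j)
  low : Low dS 1 Δ

def Nfree (y : ℕ → ℕ → R) (N : ℕ) : Subalgebra ℚ R :=
  Algebra.adjoin ℚ {z | ∃ i j, i ≠ N ∧ j ≠ N ∧ z = y i j}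

theorem Nfree_y {y : ℕ → ℕ → R} {N i j : ℕ} (hi : i ≠ N) (hj : j ≠ N) : y i j ∈ Nfree y N :=
  Algebra.subset_adjoin ⟨i, j, hi, hj, rfl⟩

variable {y : ℕ → ℕ → R} {dS : ℕ → Submodule ℚ R}

theorem Sk.one (hG : Gr dS) {p N : ℕ} {Δ : R →ₗ[ℚ] R} {s : R →ₐ[ℚ] R} (h : Sk y dS p N Δ s) :
    Δ 1 = 0 := (h.low 0 1 hG.one).1 (by omega)

theorem Sk.free (hG : Gr dS) {p N : ℕ} {Δ : R →ₗ[ℚ] R} {s : R →ₐ[ℚ] R} (h : Sk y dS p N Δ s)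
    {u : R} (hu : u ∈ Nfree y N) : Δ u = 0 := by
  induction hu using Algebra.adjoin_induction with
  | mem z hz =>
    obtain ⟨i, j, hi, hj, rfl⟩ := hz
    exact h.y0 i j (fun h => hj h.2) (fun h => hi h.1)
  | algebraMap r => rw [Algebra.algebraMap_eq_smul_one, map_smul, h.one hG, smul_zero]
  | add a b _ _ ha hb => rw [map_add, ha, hb, add_zero]
  | mul a b _ _ ha hb => rw [h.leib, ha, hb]; simp

theorem Sk.lin (hG : Gr dS) {p N : ℕ} {Δ : R →ₗ[ℚ] R} {s : R →ₐ[ℚ] R} (h : Sk y dS p N Δ s)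
    {u : R} (hu : u ∈ Nfree y N) (z : R) : Δ (u * z) = u * Δ z := by
  rw [h.leib, h.free hG hu]; simp

def Tw (y : ℕ → ℕ → R) : ℕ → ℕ → R
  | 0, N => y N 0 * y N 1 * y N 0
  | q+1, N => y (q+2) N * Tw y q (q+2) * y (q+2) N

theorem Tw_map {s : R →ₐ[ℚ] R} {σ : ℕ → ℕ} (hs : ∀ i j, s (y i j) = y (σ i) (σ j)) (q : ℕ)
    (hσ : ∀ i < q + 2, σ i = i) (M : ℕ) : s (Tw y q M) = Tw y q (σ M) := by
  induction q generalizing M with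
  | zero => simp [Tw, hs, hσ 0 (by omega), hσ 1 (by omega)]
  | succ q ih =>
    simp only [Tw, map_mul, hs]
    rw [ih (fun i hi => hσ i (by omega)), hσ (q+2) (by omega)]

theorem Tw_free (q : ℕ) {M N : ℕ} (hM : M ≠ N) (hN : q + 2 ≤ N) : Tw y q M ∈ Nfree y N := by
  induction q generalizing M with
  | zero =>
    exact mul_mem (mul_mem (Nfree_y hM (by omega)) (Nfree_y hM (by omega))) (Nfree_y hM (by omega))
  | succ q ih =>
    exact mul_mem (mul_mem (Nfree_y (by omega) hM) (ih (by omega) (by omega)))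
      (Nfree_y (by omega) hM)

theorem D_exists (hG : Gr dS) (n : ℕ) (hanti : ∀ i j, y j i = - y i j)
    (hSk : ∀ p N, p < n → N < n → p ≠ N → ∃ Δ s, Sk y dS p N Δ s) (q : ℕ) :
    ∀ N, q + 2 ≤ N → N < n → ∃ D : R →ₗ[ℚ] R,
      (∀ u ∈ Nfree y N, ∀ z, D (u * z) = u * D z) ∧
      (∀ j l, q + 2 ≤ j → q + 2 ≤ l → ∀ u, D (u * y j l) = D u * y j l) ∧
      Low dS (2 * q + 3) D ∧
      (∀ j, q + 2 ≤ j → j ≠ N → ∀ t ∈ Nfree y N, D (y j N * t) = 0) ∧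
      D (Tw y q N) = 1 := by
  induction q with
  | zero =>
    intro N hN hNn
    obtain ⟨Δ0, s0, h0⟩ := hSk 0 N (by omega) hNn (by omega)
    obtain ⟨Δ1, s1, h1⟩ := hSk 1 N (by omega) hNn (by omega)
    refine ⟨-(Δ0 ∘ₗ Δ1 ∘ₗ Δ0), ?_, ?_, ?_, ?_, ?_⟩
    · intro u hu z
      simp [h0.lin hG hu, h1.lin hG hu]
    · intro j l hj hl u
      have a0 : Δ0 (y j l) = 0 := h0.y0 _ _ (by omega) (by omega)
      have b : ∀ k, 2 ≤ k → Equiv.swap 0 N k ≠ 1 ∧ Equiv.swap 0 N k ≠ N ∧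
          Equiv.swap 1 N (Equiv.swap 0 N k) = Equiv.swap 0 N k := by
        intro k hk
        by_cases hkN : k = N
        · subst hkN
          rw [Equiv.swap_apply_right]
          exact ⟨by omega, by omega, Equiv.swap_apply_of_ne_of_ne (by omega) (by omega)⟩
        · rw [Equiv.swap_apply_of_ne_of_ne (by omega) hkN]
          exact ⟨by omega, hkN, Equiv.swap_apply_of_ne_of_ne (by omega) hkN⟩
      obtain ⟨b1, b2, b3⟩ := b j hj
      obtain ⟨c1, c2, c3⟩ := b l hl
      have a1 : Δ1 (y (Equiv.swap 0 N j) (Equiv.swap 0 N l)) = 0 :=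
        h1.y0 _ _ (fun h => b1 h.1) (fun h => c1 h.2)
      have a2 : Δ0 (y (Equiv.swap 0 N j) (Equiv.swap 0 N l)) = 0 :=
        h0.y0 _ _ (fun h => c2 h.2) (fun h => b2 h.1)
      simp [h0.leib, h1.leib, a0, a1, a2, h0.sy, h1.sy, b3, c3]
    · exact ((h0.low.comp h1.low).comp h0.low).neg
    · intro j hj hjN t ht
      have a0 : Δ0 (y j N) = 0 := h0.y0 _ _ (by omega) (by omega)
      simp [h0.leib, a0, h0.free hG ht]
    · have e1 : Δ0 (y N 1) = 0 := h0.y0 _ _ (by omega) (by omega)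
      have e2 : Δ1 (y N 0) = 0 := h1.y0 _ _ (by omega) (by omega)
      have e3 : Δ1 (y 0 1) = 0 := h1.y0 _ _ (by omega) (by omega)
      have e4 : Δ1 (y 0 N) = 0 := h1.y0 _ _ (by omega) (by omega)
      have e5 : Equiv.swap 0 N 1 = 1 := Equiv.swap_apply_of_ne_of_ne (by omega) (by omega)
      simp [Tw, h0.leib, h1.leib, e1, e2, e3, e4, h0.y2, h1.y2, h0.sy, e5]
  | succ q ih =>
    intro N hN hNn
    obtain ⟨D, d1, d2, d3, d4, d5⟩ := ih N (by omega) hNn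
    obtain ⟨Δ, s, h⟩ := hSk (q+2) N (by omega) hNn (by omega)
    refine ⟨-(Δ ∘ₗ D ∘ₗ Δ), ?_, ?_, ?_, ?_, ?_⟩
    · intro u hu z
      simp [h.lin hG hu, d1 u hu]
    · intro j l hj hl u
      have a0 : Δ (y j l) = 0 := h.y0 _ _ (by omega) (by omega)
      have b : ∀ k, q + 3 ≤ k → q + 2 ≤ Equiv.swap (q+2) N k ∧ Equiv.swap (q+2) N k ≠ N := by
        intro k hk
        simp only [Equiv.swap_apply_def]
        split_ifs <;> omega
      obtain ⟨b1, b2⟩ := b j hj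
      obtain ⟨c1, c2⟩ := b l hl
      have a2 : Δ (y (Equiv.swap (q+2) N j) (Equiv.swap (q+2) N l)) = 0 :=
        h.y0 _ _ (fun h => c2 h.2) (fun h => b2 h.1)
      simp [h.leib, a0, h.sy, d2 _ _ b1 c1, a2]
    · have := ((h.low.comp d3).comp h.low).neg
      rwa [show 1 + (2 * q + 3) + 1 = 2 * (q+1) + 3 by ring] at this
    · intro j hj hjN t ht
      have a0 : Δ (y j N) = 0 := h.y0 _ _ (by omega) (by omega)
      simp [h.leib, a0, h.free hG ht]
    · have hf : Tw y q (q+2) ∈ Nfree y N := Tw_free q (by omega) (by omega)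
      have hs : s (Tw y q (q+2)) = Tw y q N := by
        rw [Tw_map h.sy q (fun i hi => Equiv.swap_apply_of_ne_of_ne (by omega) (by omega)),
          Equiv.swap_apply_left]
      have e : Δ (Tw y (q+1) N) = y (q+2) N * Tw y q (q+2) - Tw y q N * y (q+2) N := by
        simp only [Tw, h.leib, h.y1, h.free hG hf, hs, h.sy, Equiv.swap_apply_left,
          Equiv.swap_apply_right, hanti (q+2) N]
        noncomm_ring
      have e2 : D (Δ (Tw y (q+1) N)) = - y (q+2) N := by
        rw [e, map_sub, d4 (q+2) le_rfl (by omega) _ hf, d2 _ _ le_rfl (by omega), d5]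
        simp
      simp [e2, h.y1]

end Skew

section NatRels
variable {R : Type*} [Ring R]

/-- The relations, for generators indexed by natural numbers. -/
structure YRels (y : ℕ → ℕ → R) : Prop where
  anti : ∀ i j, y j i = - y i j
  sq : ∀ i j, y i j * y i j = 0
  comm : ∀ i j k l, i ≠ k → i ≠ l → j ≠ k → j ≠ l → i ≠ j → k ≠ l → y i j * y k l = y k l * y i j
  cyc : ∀ i j k, i ≠ j → j ≠ k → i ≠ k → y i j * y j k + y j k * y k i + y k i * y i j = 0

variable {y : ℕ → ℕ → R}

theorem YRels.star (h : YRels y) (i j k : ℕ) (h1 : i ≠ j) (h2 : j ≠ k) (h3 : i ≠ k) :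
    y i j * y i k * y i j = - (y i k * y i j * y i k) := by
  have c := h.cyc i j k h1 h2 h3
  have a := h.sq i j
  have b := h.sq k i
  rw [h.anti k i]
  have e1 : y i j * (y i j * y j k + y j k * y k i + y k i * y i j) = 0 := by rw [c, mul_zero]
  have e2 : (y i j * y j k + y j k * y k i + y k i * y i j) * y k i = 0 := by rw [c, zero_mul]
  have e3 : y i j * y j k * y k i + y i j * y k i * y i j = 0 := by
    calc _ = y i j * (y i j * y j k + y j k * y k i + y k i * y i j) - (y i j * y i j) * y j k := by
          noncomm_ring
      _ = 0 := by rw [e1, a]; simp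
  have e4 : y i j * y j k * y k i + y k i * y i j * y k i = 0 := by
    calc _ = (y i j * y j k + y j k * y k i + y k i * y i j) * y k i - y j k * (y k i * y k i) := by
          noncomm_ring
      _ = 0 := by rw [e2, b]; simp
  have e5 : y i j * y k i * y i j = y k i * y i j * y k i := by
    rw [eq_neg_of_add_eq_zero_right e3, eq_neg_of_add_eq_zero_right e4]
  calc y i j * -y k i * y i j = - (y i j * y k i * y i j) := by noncomm_ring
    _ = _ := by rw [e5]; noncomm_ring

theorem YRels.claw (h : YRels y) (i j k l : ℕ) (h1 : i ≠ j) (h2 : i ≠ k) (h3 : i ≠ l)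
    (h4 : j ≠ k) (h5 : j ≠ l) (h6 : k ≠ l) :
    y i l * y i j * y i k * y i l =
      - (y i j * y i k * y i l * y i j) - y i k * y i l * y i j * y i k := by
  have c := h.cyc j i k h1.symm h2 h4
  rw [h.anti i j] at c
  have ab : y i j * y i k = y i k * y k j - y k j * y i j := by
    rw [← sub_eq_zero, ← neg_eq_zero, ← c]; noncomm_ring
  clear c
  have yc : y k j * y i l = y i l * y k j := h.comm k j i l h2.symm h6 h1.symm h5 h4.symm h3
  have s1 := h.star i j l h1 h5 h3
  have s2 := h.star i k l h2 h6 h3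
  generalize y i j = a at *
  generalize y i k = b at *
  generalize y i l = c at *
  generalize y k j = z at *
  have t1 : a * b * c * a = b * c * z * a - z * (a * c * a) := by
    rw [ab]
    calc _ = b * (z * c) * a - z * (a * c * a) := by noncomm_ring
      _ = _ := by rw [yc]; noncomm_ring
  have t2 : b * c * a * b = b * c * b * z - b * c * z * a := by
    calc _ = b * c * (a * b) := by noncomm_ring
      _ = _ := by rw [ab]; noncomm_ring
  have t3 : c * a * b * c = c * b * c * z - z * (c * a * c) := by
    calc _ = c * (a * b) * c := by noncomm_ring
      _ = c * b * (z * c) - (c * z) * a * c := by rw [ab]; noncomm_ring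
      _ = c * b * (c * z) - (z * c) * a * c := by rw [yc]
      _ = _ := by noncomm_ring
  rw [t1, t2, t3, s1, s2]
  noncomm_ring

theorem YRels.rels (h : YRels y) :
    Rels (fun t : Bool => y 2 t.toNat) (fun i => y (i+2) (i+3)) where
  gg t := h.sq _ _
  gbr t := by cases t <;> exact h.star _ _ _ (by decide) (by decide) (by decide)
  ff i := h.sq _ _
  fbr i := by
    have := h.star (i+3) (i+2) (i+4) (by omega) (by omega) (by omega)
    rw [h.anti (i+2) (i+3)] at this
    simpa using this
  fcomm i j hij := h.comm _ _ _ _ (by omega) (by omega) (by omega) (by omega) (by omega) (by omega)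
  gf t i := by
    have : t.toNat ≤ 1 := Bool.toNat_le t
    exact h.comm _ _ _ _ (by omega) (by omega) (by omega) (by omega) (by omega) (by omega)
  gfbr t := by
    have : t.toNat ≤ 1 := Bool.toNat_le t
    exact h.star _ _ _ (by omega) (by omega) (by omega)
  claw t := by
    cases t <;> exact h.claw _ _ _ _ (by decide) (by decide) (by decide) (by decide) (by decide)
      (by decide)

end NatRels

section Concrete
variable {n : ℕ}

def yR {B : Type*} [Ring B] (φ : Fin n → Fin n → B) (i j : ℕ) : B :=
  if h : i < n ∧ j < n then φ ⟨i, h.1⟩ ⟨j, h.2⟩ else 0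

theorem yR_of_lt {B : Type*} [Ring B] (φ : Fin n → Fin n → B) {i j : ℕ} (hi : i < n) (hj : j < n) :
    yR φ i j = φ ⟨i, hi⟩ ⟨j, hj⟩ := dif_pos ⟨hi, hj⟩

theorem yR_of_not {B : Type*} [Ring B] (φ : Fin n → Fin n → B) {i j : ℕ} (h : ¬ (i < n ∧ j < n)) :
    yR φ i j = 0 := dif_neg h

theorem yR_rels {B : Type*} [Ring B] {φ : Fin n → Fin n → B} (h : FKRels φ) : YRels (yR φ) where
  anti i j := by
    by_cases hh : i < n ∧ j < n
    · rw [yR_of_lt φ hh.1 hh.2, yR_of_lt φ hh.2 hh.1]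
      by_cases hij : i = j
      · subst hij; simp [h.diag]
      · exact h.antisymm _ _ (by simpa using hij)
    · rw [yR_of_not φ hh, yR_of_not φ (fun h => hh ⟨h.2, h.1⟩), neg_zero]
  sq i j := by
    by_cases hh : i < n ∧ j < n
    · rw [yR_of_lt φ hh.1 hh.2]
      by_cases hij : i = j
      · subst hij; simp [h.diag]
      · exact h.square _ _ (by simpa using hij)
    · rw [yR_of_not φ hh, zero_mul]
  comm i j k l h1 h2 h3 h4 h5 h6 := by
    by_cases hh : i < n ∧ j < n
    · by_cases hh' : k < n ∧ l < n
      · rw [yR_of_lt φ hh.1 hh.2, yR_of_lt φ hh'.1 hh'.2]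
        exact h.comm _ _ _ _ (by simp; tauto)
      · rw [yR_of_not φ hh']; simp
    · rw [yR_of_not φ hh]; simp
  cyc i j k h1 h2 h3 := by
    by_cases hi : i < n
    · by_cases hj : j < n
      · by_cases hk : k < n
        · rw [yR_of_lt φ hi hj, yR_of_lt φ hj hk, yR_of_lt φ hk hi]
          exact h.cyclic _ _ _ (by simp; tauto)
        · rw [yR_of_not φ (i := j) (j := k) (by tauto), yR_of_not φ (i := k) (by tauto)]; simp
      · rw [yR_of_not φ (i := i) (j := j) (by tauto), yR_of_not φ (i := j) (by tauto)]; simp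
    · rw [yR_of_not φ (i := i) (j := j) (by tauto), yR_of_not φ (i := k) (j := i) (by tauto)]; simp

theorem E_ind {P : E n → Prop} (h1 : ∀ r : ℚ, P (algebraMap ℚ (E n) r)) (h2 : ∀ i j, P (x n i j))
    (h3 : ∀ a b, P a → P b → P (a * b)) (h4 : ∀ a b, P a → P b → P (a + b)) (z : E n) : P z := by
  obtain ⟨w, rfl⟩ := RingQuot.mkAlgHom_surjective ℚ (Rel n) z
  induction w using FreeAlgebra.induction with
  | grade0 r => simpa using h1 r
  | grade1 p => exact h2 p.1 p.2
  | mul a b ha hb => rw [map_mul]; exact h3 _ _ ha hb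
  | add a b ha hb => rw [map_add]; exact h4 _ _ ha hb

theorem word_deg {l : List (Fin n × Fin n)} (h : ∀ p ∈ l, p.1 ≠ p.2) {d : ℕ} (hd : l.length = d) :
    word n l ∈ degSpan n d := Submodule.subset_span ⟨l, h, hd, rfl⟩

theorem deg_gr : Gr (degSpan n) where
  one := by
    have := word_deg (n := n) (l := []) (by simp) rfl
    simpa [word] using this
  mul := by
    intro i j a b ha hb
    have : degSpan n i * degSpan n j ≤ degSpan n (i + j) := by
      rw [degSpan, degSpan, Submodule.span_mul_span, Submodule.span_le]
      rintro _ ⟨_, ⟨l, hl, hl', rfl⟩, _, ⟨m, hm, hm', rfl⟩, rfl⟩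
      have := word_deg (n := n) (l := l ++ m) (d := i + j) (by
        intro p hp
        rcases List.mem_append.1 hp with hp | hp
        · exact hl p hp
        · exact hm p hp) (by simp [hl', hm'])
      simpa [word] using this
    exact this (Submodule.mul_mem_mul ha hb)

theorem x_deg (i j : Fin n) : x n i j ∈ degSpan n 1 := by
  by_cases h : i = j
  · subst h
    rw [x_rels.diag]; exact Submodule.zero_mem _
  · have := word_deg (n := n) (l := [(i, j)]) (d := 1) (by simpa using h) rfl
    simpa [word] using this

theorem y_deg (i j : ℕ) : yR (x n) i j ∈ degSpan n 1 := by
  by_cases h : i < n ∧ j < n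
  · rw [yR_of_lt _ h.1 h.2]; exact x_deg _ _
  · rw [yR_of_not _ h]; exact Submodule.zero_mem _

/-- Two graded pieces-respecting maps: a way to do induction on words. -/
theorem deg_ind {d : ℕ} {M : Submodule ℚ (E n)}
    (h : ∀ l : List (Fin n × Fin n), l.length = d → word n l ∈ M) : degSpan n d ≤ M := by
  rw [degSpan, Submodule.span_le]
  rintro _ ⟨l, -, hl, rfl⟩
  exact h l hl

theorem word_cons (p : Fin n × Fin n) (l : List (Fin n × Fin n)) :
    word n (p :: l) = x n p.1 p.2 * word n l := by simp [word]

theorem word_deg' (l : List (Fin n × Fin n)) : word n l ∈ degSpan n l.length := by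
  induction l with
  | nil => simpa [word] using (deg_gr (n := n)).one
  | cons p l ih =>
    rw [word_cons]
    have := deg_gr.mul (x_deg p.1 p.2) ih
    rwa [add_comm] at this

theorem sk_exists_fin (p q : Fin n) (hpq : p ≠ q) :
    ∃ (Δ : E n →ₗ[ℚ] E n) (s : E n →ₐ[ℚ] E n),
      (∀ u v, Δ (u * v) = u * Δ v + Δ u * s v) ∧
      (∀ i j, Δ (x n i j) = delR (E n) p q i j) ∧
      (∀ i j, s (x n i j) = x n (Equiv.swap p q i) (Equiv.swap p q j)) := by
  have hr := mat_rels (x_rels (n := n)) p q hpq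
  set m := liftE _ hr with hm
  have mx : ∀ i j, m (x n i j) =
    !![x n i j, delR (E n) p q i j; 0, x n (Equiv.swap p q i) (Equiv.swap p q j)] :=
    fun i j => liftE_x _ hr i j
  have key : ∀ z, m z 0 0 = z ∧ m z 1 0 = 0 ∧ m z 1 1 = sE (Equiv.swap p q) z := by
    intro z
    induction z using E_ind with
    | h1 r =>
      rw [AlgHom.commutes, AlgHom.commutes]
      simp [Matrix.algebraMap_matrix_apply]
    | h2 i j => rw [mx, sE_x]; simp
    | h3 a b ha hb =>
      obtain ⟨a1, a2, a3⟩ := ha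
      obtain ⟨b1, b2, b3⟩ := hb
      simp only [map_mul, Matrix.mul_apply, Fin.sum_univ_two, a1, a2, a3, b1, b2, b3]
      simp
    | h4 a b ha hb =>
      obtain ⟨a1, a2, a3⟩ := ha
      obtain ⟨b1, b2, b3⟩ := hb
      simp only [map_add, Matrix.add_apply, a1, a2, a3, b1, b2, b3]
      simp
  refine ⟨(Matrix.entryLinearMap ℚ (E n) 0 1) ∘ₗ m.toLinearMap, sE (Equiv.swap p q), ?_, ?_, ?_⟩
  · intro u v
    simp only [LinearMap.comp_apply, AlgHom.toLinearMap_apply, Matrix.entryLinearMap_apply, map_mul,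
      Matrix.mul_apply, Fin.sum_univ_two, (key u).1, (key v).2.2]
  · intro i j
    simp [mx]
  · intro i j; exact sE_x _ _ _

theorem sk_exists (p N : ℕ) (hp : p < n) (hN : N < n) (hpN : p ≠ N) :
    ∃ Δ s, Sk (yR (x n)) (degSpan n) p N Δ s := by
  obtain ⟨Δ, s, h1, h2, h3⟩ := sk_exists_fin (n := n) ⟨p, hp⟩ ⟨N, hN⟩ (by simpa using hpN)
  have hone : Δ 1 = 0 := by
    have := h1 1 1
    simp only [map_one, mul_one, one_mul] at this
    exact left_eq_add.1 this
  have hs : ∀ l, s (word n l) ∈ degSpan n l.length := by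
    intro l
    induction l with
    | nil => simpa [word] using (deg_gr (n := n)).one
    | cons a l ih =>
      rw [word_cons, map_mul, h3]
      have := deg_gr.mul (x_deg (Equiv.swap (⟨p, hp⟩ : Fin n) ⟨N, hN⟩ a.1)
        (Equiv.swap (⟨p, hp⟩ : Fin n) ⟨N, hN⟩ a.2)) ih
      rw [add_comm] at this
      exact this
  have hdel : ∀ a b i j : Fin n, delR (E n) a b i j ∈ degSpan n 0 := by
    intro a b i j
    unfold delR
    split_ifs
    · exact deg_gr.one
    · exact Submodule.neg_mem _ deg_gr.one
    · exact Submodule.zero_mem _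
  have hw : ∀ d l, l.length = d + 1 → Δ (word n l) ∈ degSpan n d := by
    intro d
    induction d with
    | zero =>
      intro l hl
      obtain ⟨a, rfl⟩ := List.length_eq_one_iff.1 hl
      simpa [word, h2] using hdel _ _ _ _
    | succ d ih =>
      intro l hl
      cases l with
      | nil => simp at hl
      | cons a l =>
        have hl' : l.length = d + 1 := by simpa using hl
        rw [word_cons, h1, h2]
        apply Submodule.add_mem
        · have := deg_gr.mul (x_deg a.1 a.2) (ih l hl')
          rwa [add_comm] at this
        · have := deg_gr.mul (hdel ⟨p, hp⟩ ⟨N, hN⟩ a.1 a.2) (hs l)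
          rwa [hl', zero_add] at this
  refine ⟨Δ, s, h1, ?_, ?_, ?_, ?_, ?_⟩
  · rw [yR_of_lt _ hp hN, h2]; simp [delR]
  · rw [yR_of_lt _ hN hp, h2]; simp [delR, hpN, hpN.symm]
  · intro i j hi hj
    by_cases h : i < n ∧ j < n
    · rw [yR_of_lt _ h.1 h.2, h2]; simp [delR, hi, hj]
    · rw [yR_of_not _ h, map_zero]
  · intro i j
    have hlt : ∀ k, k < n ↔ Equiv.swap p N k < n := by
      intro k
      rw [Equiv.swap_apply_def]
      split_ifs <;> omega
    have hval : ∀ k (hk : k < n), Equiv.swap (⟨p, hp⟩ : Fin n) ⟨N, hN⟩ ⟨k, hk⟩ =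
        ⟨Equiv.swap p N k, (hlt k).1 hk⟩ := by
      intro k hk
      simp only [Equiv.swap_apply_def, Fin.mk.injEq, Fin.ext_iff]
      split_ifs <;> rfl
    by_cases h : i < n ∧ j < n
    · rw [yR_of_lt _ h.1 h.2, h3, yR_of_lt _ ((hlt i).1 h.1) ((hlt j).1 h.2), hval, hval]
    · rw [yR_of_not _ h, map_zero, yR_of_not]
      rwa [← hlt, ← hlt]
  · intro d z hz
    constructor
    · intro hd
      obtain rfl : d = 0 := by omega
      have : degSpan n 0 ≤ LinearMap.ker Δ := deg_ind (by
        intro l hl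
        rw [List.length_eq_zero_iff.1 hl]
        simp [word, hone])
      exact this hz
    · intro hd
      obtain ⟨d, rfl⟩ : ∃ e, d = e + 1 := ⟨d - 1, by omega⟩
      have : degSpan n (d+1) ≤ (degSpan n d).comap Δ := deg_ind (fun l hl => hw d l hl)
      exact this hz

/-- Projection to the degree `d` part. -/
theorem proj_exists (d : ℕ) : ∃ π : E n →ₗ[ℚ] E n, (∀ z ∈ degSpan n d, π z = z) ∧
    ∀ e ≠ d, ∀ z ∈ degSpan n e, π z = 0 := by
  have hx := x_rels (n := n)
  have hr : FKRels (fun i j => Polynomial.monomial 1 (x n i j)) := by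
    constructor
    · intro i; simp [hx.diag]
    · intro i j h; rw [hx.antisymm _ _ h, Polynomial.monomial_neg]
    · intro i j h; rw [Polynomial.monomial_mul_monomial, hx.square _ _ h, Polynomial.monomial_zero_right]
    · intro i j k l h
      rw [Polynomial.monomial_mul_monomial, Polynomial.monomial_mul_monomial, hx.comm _ _ _ _ h]
    · intro i j k h
      simp only [Polynomial.monomial_mul_monomial]
      rw [← map_add, ← map_add, hx.cyclic _ _ _ h, map_zero]
  set m := liftE _ hr with hm
  have mx : ∀ i j, m (x n i j) = Polynomial.monomial 1 (x n i j) := fun i j => liftE_x _ hr i j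
  have mw : ∀ l, m (word n l) = Polynomial.monomial l.length (word n l) := by
    intro l
    induction l with
    | nil => simp [word]
    | cons p l ih =>
      rw [word_cons, map_mul, ih, mx, Polynomial.monomial_mul_monomial, List.length_cons, add_comm]
  let c : Polynomial (E n) →ₗ[ℚ] E n :=
    { toFun := fun p => p.coeff d
      map_add' := fun a b => Polynomial.coeff_add a b d
      map_smul' := fun r a => Polynomial.coeff_smul r a d }
  have cm : ∀ l, c (m (word n l)) = if l.length = d then word n l else 0 := by
    intro l
    rw [mw]
    exact Polynomial.coeff_monomial
  refine ⟨c ∘ₗ m.toLinearMap, ?_, ?_⟩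
  · intro z hz
    have : degSpan n d ≤ LinearMap.eqLocus (c ∘ₗ m.toLinearMap) LinearMap.id := deg_ind (by
      intro l hl
      rw [LinearMap.mem_eqLocus]
      simp [cm, hl])
    exact this hz
  · intro e he z hz
    have : degSpan n e ≤ LinearMap.ker (c ∘ₗ m.toLinearMap) := deg_ind (by
      intro l hl
      rw [LinearMap.mem_ker]
      simp [cm, hl, he])
    exact this hz

end Concrete

section Final
open Polynomial

theorem hilb_deg {M : Type*} [AddCommGroup M] [Module ℚ M] {dS : ℕ → Submodule ℚ M}
    (d : ℕ) (hp : ∃ π : M →ₗ[ℚ] M, (∀ z ∈ dS d, π z = z) ∧ ∀ e ≠ d, ∀ z ∈ dS e, π z = 0)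
    {A : Submodule ℚ M} {ι : Type} [Fintype ι] (deg : ι → ℕ) (v : ι → M)
    (hv : LinearIndependent ℚ v) (hd : ∀ i, v i ∈ dS (deg i))
    (hs : Submodule.span ℚ (Set.range v) = A) :
    Module.finrank ℚ ↥(A ⊓ dS d) = (∑ i, (X : ℕ[X]) ^ deg i).coeff d := by
  obtain ⟨π, h1, h2⟩ := hp
  have hli : LinearIndependent ℚ (fun i : {i // deg i = d} => v i.1) :=
    hv.comp _ Subtype.val_injective
  have hsp : A ⊓ dS d = Submodule.span ℚ (Set.range (fun i : {i // deg i = d} => v i.1)) := by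
    apply le_antisymm
    · rintro z ⟨hz1, hz2⟩
      rw [SetLike.mem_coe, ← hs] at hz1
      have hle : Submodule.span ℚ (Set.range v) ≤
          (Submodule.span ℚ (Set.range (fun i : {i // deg i = d} => v i.1))).comap π := by
        rw [Submodule.span_le]
        rintro _ ⟨i, rfl⟩
        rw [SetLike.mem_coe, Submodule.mem_comap]
        by_cases hi : deg i = d
        · rw [h1 _ (hi ▸ hd i)]
          exact Submodule.subset_span ⟨⟨i, hi⟩, rfl⟩
        · rw [h2 _ hi _ (hd i)]; exact Submodule.zero_mem _
      have := hle hz1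
      rwa [Submodule.mem_comap, h1 z hz2] at this
    · rw [Submodule.span_le]
      rintro _ ⟨⟨i, hi⟩, rfl⟩
      exact ⟨hs ▸ Submodule.subset_span ⟨i, rfl⟩, hi ▸ hd i⟩
  rw [hsp, finrank_span_eq_card hli, Polynomial.finsetSum_coeff]
  simp only [Polynomial.coeff_X_pow]
  rw [Finset.sum_boole, Fintype.card_subtype]
  simp [eq_comm]

theorem poly_id (m : ℕ) : ∏ q ∈ Finset.range (m + 1), (qint (q + 3) * (1 + X ^ (q + 1))) =
    qint (m + 3) * qint (m + 2) * ∏ i ∈ Finset.Icc 2 (m + 1), qint (2 * i) := by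
  induction m with
  | zero =>
    have h1 : qint 1 = 1 := by simp [qint]
    have h2 := qint_two_mul 1
    rw [h1] at h2
    simp only [mul_one, one_mul] at h2
    simp [h2]
  | succ m ih =>
    rw [Finset.prod_range_succ, ih, Finset.prod_Icc_succ_top (b := m + 1) (by omega), qint_two_mul (m + 1 + 1)]
    ring

theorem qint_eval (k : ℕ) : (qint k).eval 1 = k := by
  simp [qint, Polynomial.eval_finsetSum]

theorem dim_id (m : ℕ) :
    (∏ q ∈ Finset.range (m + 1), (qint (q + 3) * (1 + X ^ (q + 1)))).eval 1 =
      2 ^ m * (m + 3).factorial := by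
  induction m with
  | zero => simp [qint_eval, Nat.factorial]
  | succ m ih =>
    rw [Finset.prod_range_succ, Polynomial.eval_mul, ih, Nat.factorial_succ (m + 3)]
    simp only [Polynomial.eval_mul, qint_eval, Polynomial.eval_add, Polynomial.eval_one,
      Polynomial.eval_pow, Polynomial.eval_X, one_pow]
    ring

theorem tt_eq {R : Type*} [Ring R] (y : ℕ → ℕ → R) (q : ℕ) :
    tt (fun t : Bool => y 2 t.toNat) (fun i => y (i+2) (i+3)) q = Tw y q (q+2) := by
  induction q with
  | zero => rfl
  | succ q ih => rw [tt, ih]; rfl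

theorem AA_le {R : Type*} [Ring R] [Algebra ℚ R] (y : ℕ → ℕ → R) (q : ℕ) :
    AA (fun t : Bool => y 2 t.toNat) (fun i => y (i+2) (i+3)) q ≤ Nfree y (q+2) := by
  apply Algebra.adjoin_le
  cases q with
  | zero => rintro z ⟨⟩
  | succ q =>
    rintro z (⟨t, rfl⟩ | ⟨i, hi, rfl⟩)
    · exact Nfree_y (by omega) (by cases t <;> simp)
    · have hi' : i < q := hi
      exact Nfree_y (by omega) (by omega)

theorem EG_eq (n : ℕ) (hn : 4 ≤ n) : EG n (dynkinD n) =
    AA (fun t : Bool => yR (x n) 2 t.toNat) (fun i => yR (x n) (i+2) (i+3)) (n - 2) := by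
  obtain ⟨m, rfl⟩ : ∃ m, n = m + 3 := ⟨n - 3, by omega⟩
  have hm : m + 3 - 2 = m + 1 := by omega
  have ha := (yR_rels (x_rels (n := m + 3))).anti
  rw [hm]
  apply le_antisymm
  · apply Algebra.adjoin_le
    rintro _ ⟨i, j, hij, rfl⟩
    have hy : x (m+3) i j = yR (x (m+3)) i j := (yR_of_lt _ i.2 j.2).symm
    have key : ∀ a b : Fin (m+3), (((a : ℕ) = 0 ∧ (b : ℕ) = 2) ∨ ((a : ℕ) = 1 ∧ (b : ℕ) = 2) ∨
      (2 ≤ (a : ℕ) ∧ (b : ℕ) = (a : ℕ) + 1)) → 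
      yR (x (m+3)) a b ∈ AA (fun t : Bool => yR (x (m+3)) 2 t.toNat)
        (fun i => yR (x (m+3)) (i+2) (i+3)) (m+1) := by
      rintro a b (⟨h1, h2⟩ | ⟨h1, h2⟩ | ⟨h1, h2⟩)
      · rw [h1, h2, ha 2 0]
        exact neg_mem (g_mem (g := fun t : Bool => yR (x (m+3)) 2 t.toNat) false m)
      · rw [h1, h2, ha 2 1]
        exact neg_mem (g_mem (g := fun t : Bool => yR (x (m+3)) 2 t.toNat) true m)
      · obtain ⟨c, hc⟩ : ∃ c, (a : ℕ) = c + 2 := ⟨a - 2, by omega⟩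
        rw [h2, hc]
        exact f_mem (f := fun i => yR (x (m+3)) (i+2) (i+3)) (i := c) (by omega)
    rw [hy]
    rw [dynkinD, SimpleGraph.fromRel_adj] at hij
    rcases hij.2 with h | h
    · exact key i j h
    · rw [ha j i]; exact neg_mem (key j i h)
  · apply Algebra.adjoin_le
    rintro z (⟨t, rfl⟩ | ⟨i, hi, rfl⟩)
    · have ht : t.toNat < m + 3 := by cases t <;> simp
      refine Algebra.subset_adjoin ⟨⟨2, by omega⟩, ⟨t.toNat, ht⟩, ?_, yR_of_lt _ _ _⟩
      rw [dynkinD, SimpleGraph.fromRel_adj]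
      cases t <;> simp
    · have hi' : i < m := hi
      refine Algebra.subset_adjoin ⟨⟨i+2, by omega⟩, ⟨i+3, by omega⟩, ?_, yR_of_lt _ _ _⟩
      rw [dynkinD, SimpleGraph.fromRel_adj]
      simp

end Final

/-- for `n ≥ 4`, the Hilbert series of `E_{D_n}` equals
`[n]·[n-1]·[4]·[6]⋯[2n-4]`; in particular `E_{D_n}` is finite-dimensional of dimension
`2^{n-3}·n!`. -/
theorem stmt19 (n : ℕ) (hn : 4 ≤ n) :
    FiniteDimensional ℚ ↥(EG n (dynkinD n)) ∧
    (∀ d : ℕ, Module.finrank ℚ ↥(EGdeg n (dynkinD n) d) =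
      (qint n * qint (n - 1) * ∏ i ∈ Finset.Icc 2 (n - 2), qint (2 * i)).coeff d) ∧
    Module.finrank ℚ ↥(EG n (dynkinD n)) = 2 ^ (n - 3) * n.factorial := by
  have hY := yR_rels (x_rels (n := n))
  obtain ⟨ι, _, deg, v, hv, hd, hs, hp⟩ := basis_exists hY.rels (deg_gr (n := n))
    (fun t => y_deg _ _) (fun i => y_deg _ _) (n - 2) (by
      intro q hq
      obtain ⟨D, h1, -, h3, -, h5⟩ := D_exists (deg_gr (n := n)) n (y := yR (x n))
        (fun i j => hY.anti i j) (fun p N hp hN hpN => sk_exists p N hp hN hpN) q (q+2) le_rfl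
        (by omega)
      refine ⟨D, fun u hu z => h1 u (AA_le _ q hu) z, fun d hd z hz => (h3 d z hz).1 hd, ?_⟩
      rw [tt_eq]; exact h5)
  rw [← EG_eq n hn] at hs
  obtain ⟨m, rfl⟩ : ∃ m, n = m + 3 := ⟨n - 3, by omega⟩
  have hm : m + 3 - 2 = m + 1 := by omega
  rw [hm] at hp
  have hfin : FiniteDimensional ℚ ↥(Subalgebra.toSubmodule (EG (m+3) (dynkinD (m+3)))) := by
    rw [← hs]; exact FiniteDimensional.span_of_finite ℚ (Set.finite_range v)
  refine ⟨hfin, ?_, ?_⟩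
  · intro d
    have := hilb_deg d (proj_exists d) deg v hv hd hs
    rw [hp, poly_id] at this
    exact this
  · have h1 : Module.finrank ℚ ↥(Subalgebra.toSubmodule (EG (m+3) (dynkinD (m+3)))) =
        Fintype.card ι := by
      rw [← hs]; exact finrank_span_eq_card hv
    have h2 := congrArg (Polynomial.eval 1) hp
    rw [dim_id] at h2
    simp only [Polynomial.eval_finsetSum, Polynomial.eval_pow, Polynomial.eval_X, one_pow,
      Finset.sum_const, Finset.card_univ, smul_eq_mul, mul_one] at h2
    exact h1.trans h2

end FK
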